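/- Growth estimate in the critical angle: Let Ω be an angular domain with Ω_I = {r e^{I(ζ_I + θ)} : r > 0, |θ| < φ_I/2} for all I ∈ 𝕊, and let f be a slice regular function on Ω of order ρ and type σ, continuous up to the boundary. If the opening of Ω is not greater than π/ρ and |f| is bounded by M on ∂Ω, then for all I ∈ 𝕊, all r > 0 and all |θ| < φ_I/2 one has |f(r e^{I(ζ_I + θ)})| ≤ M e^{σ r^ρ cos(ρθ)}. -/

import Mathlib

open scoped Quaternion

/-- The sphere of imaginary units in the quaternions. -/
def qSphere : Set ℍ[ℝ] := {q : ℍ[ℝ] | q.re = 0 ∧ ‖q‖ = 1}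

/-- The point of the slice `L_I = ℝ + ℝI` corresponding to `z = x + iy ∈ ℂ`. -/
noncomputable def toSlice (I : ℍ[ℝ]) (z : ℂ) : ℍ[ℝ] := (z.re : ℍ[ℝ]) + z.im • I

/-- `f` is slice regular on `Ω`: for each imaginary unit `I`, the restriction of `f` to
`Ω ∩ L_I`, read through the parametrization `toSlice I : ℂ → L_I`, is real differentiable
and satisfies the Cauchy–Riemann equation `∂f/∂x + I ∂f/∂y = 0`. -/
def SliceRegularOn (f : ℍ[ℝ] → ℍ[ℝ]) (Ω : Set ℍ[ℝ]) : Prop :=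
  ∀ I ∈ qSphere, ∀ z : ℂ, toSlice I z ∈ Ω →
    ∃ D : ℂ →L[ℝ] ℍ[ℝ],
      HasFDerivWithinAt (fun w => f (toSlice I w)) D (toSlice I ⁻¹' Ω) z ∧
      D 1 + I * D Complex.I = 0

/-- A slice domain: a domain meeting the real axis all of whose slices are domains. -/
def IsSliceDomain (Ω : Set ℍ[ℝ]) : Prop :=
  IsOpen Ω ∧ IsConnected Ω ∧ (∃ x : ℝ, (x : ℍ[ℝ]) ∈ Ω) ∧
  ∀ I ∈ qSphere, IsConnected (toSlice I ⁻¹' Ω)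

/-- `cos θ + I sin θ`. -/
noncomputable def expI (I : ℍ[ℝ]) (θ : ℝ) : ℍ[ℝ] := (Real.cos θ : ℍ[ℝ]) + Real.sin θ • I

/-- The circular cone of opening `φ` around the positive real axis. -/
def circularCone (φ : ℝ) : Set ℍ[ℝ] :=
  {q : ℍ[ℝ] | ∃ r θ : ℝ, ∃ I ∈ qSphere, 0 < r ∧ |θ| < φ / 2 ∧ q = r • expI I θ}

/-- `M_f(r)`: the maximum of `‖f‖` on the closure of `Ω` intersected with the sphere of radius `r`. -/
noncomputable def maxMod (f : ℍ[ℝ] → ℍ[ℝ]) (Ω : Set ℍ[ℝ]) (r : ℝ) : ℝ :=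
  sSup ((fun q => ‖f q‖) '' (closure Ω ∩ Metric.sphere (0 : ℍ[ℝ]) r))

/-- The order of a slice regular function. -/
noncomputable def growthOrder (f : ℍ[ℝ] → ℍ[ℝ]) (Ω : Set ℍ[ℝ]) : EReal :=
  Filter.limsup (fun r : ℝ =>
    ((max 0 (Real.log (max 0 (Real.log (maxMod f Ω r)))) / Real.log r : ℝ) : EReal))
    Filter.atTop

/-- The type of a slice regular function of order `ρ`. -/
noncomputable def growthType (f : ℍ[ℝ] → ℍ[ℝ]) (Ω : Set ℍ[ℝ]) (ρ : ℝ) : EReal :=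
  Filter.limsup (fun r : ℝ => ((max 0 (Real.log (maxMod f Ω r)) / r ^ ρ : ℝ) : EReal))
    Filter.atTop

/-- The angle of opening `φ` bisected by the half line of argument `ζ` in the slice `L_I`. -/
def angleSet (I : ℍ[ℝ]) (ζ φ : ℝ) : Set ℍ[ℝ] :=
  {q : ℍ[ℝ] | ∃ r θ : ℝ, 0 < r ∧ |θ| < φ / 2 ∧ q = r • expI I (ζ + θ)}

/-- The real affine line through `p` with direction `d`. -/
def lineSet (p d : ℍ[ℝ]) : Set ℍ[ℝ] := {q : ℍ[ℝ] | ∃ t : ℝ, q = p + t • d}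

/-- `f` is slice preserving: it maps each slice into itself. -/
def SlicePreservingOn (f : ℍ[ℝ] → ℍ[ℝ]) (Ω : Set ℍ[ℝ]) : Prop :=
  ∀ I ∈ qSphere, ∀ q ∈ Ω ∩ Set.range (toSlice I), f q ∈ Set.range (toSlice I)

/-- The principal quaternionic logarithm. -/
noncomputable def QLog (q : ℍ[ℝ]) : ℍ[ℝ] :=
  (Real.log ‖q‖ : ℍ[ℝ]) + Real.arccos (q.re / ‖q‖) • (‖q.im‖⁻¹ • q.im)

/-- Phragmén–Lindelöf principle in the right half-plane for functions of exponential type at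
most `s`: the bound on the imaginary axis propagates with the factor `exp (s * Re w)`. -/
lemma norm_le_mul_exp_of_exponential_type {h : ℂ → ℂ} {M s : ℝ}
    (hd : DiffContOnCl ℂ h {w | 0 < w.re})
    (hgrowth : ∀ τ > s, ∃ R : ℝ, ∀ w : ℂ, 0 ≤ w.re → R ≤ ‖w‖ → ‖h w‖ ≤ Real.exp (τ * ‖w‖))
    (him : ∀ y : ℝ, ‖h (y * Complex.I)‖ ≤ M) {w : ℂ} (hw : 0 ≤ w.re) :
    ‖h w‖ ≤ M * Real.exp (s * w.re) := by
  suffices H : ∀ τ > s, ‖h w‖ ≤ M * Real.exp (τ * w.re) by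
    have hc : Filter.Tendsto (fun τ : ℝ => M * Real.exp (τ * w.re)) (nhdsWithin s (Set.Ioi s))
        (nhds (M * Real.exp (s * w.re))) :=
      (Continuous.tendsto (by fun_prop) s).mono_left nhdsWithin_le_nhds
    exact ge_of_tendsto hc (eventually_nhdsWithin_of_forall H)
  intro τ hτ
  obtain ⟨R, hR⟩ := hgrowth τ hτ
  have hnorm : ∀ z : ℂ, ‖Complex.exp (-τ * z) * h z‖ = Real.exp (-τ * z.re) * ‖h z‖ := by
    intro z
    rw [norm_mul, Complex.norm_exp]
    simp
  have key : ‖Complex.exp (-τ * w) * h w‖ ≤ M := by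
    refine PhragmenLindelof.right_half_plane_of_bounded_on_real
      (f := fun z => Complex.exp (-τ * z) * h z) ?_ ⟨1, by norm_num, 2 * |τ|, ?_⟩ ?_ ?_ hw
    · have h1 : Differentiable ℂ (fun z : ℂ => Complex.exp (-τ * z)) := by fun_prop
      exact h1.diffContOnCl.smul hd
    · refine Asymptotics.IsBigO.of_bound 1 ?_
      have hlarge : ∀ᶠ z : ℂ in Bornology.cobounded ℂ, R ≤ ‖z‖ :=
        tendsto_norm_cobounded_atTop.eventually_ge_atTop R
      filter_upwards [hlarge.filter_mono inf_le_left,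
        Filter.mem_inf_of_right (Filter.mem_principal_self _)] with z hzR hz
      have hz' : 0 < z.re := hz
      rw [hnorm, Real.norm_eq_abs, Real.abs_exp, Real.rpow_one, one_mul]
      have h1 : -τ * z.re ≤ |τ| * ‖z‖ := by
        have := mul_le_mul_of_nonneg_left (Complex.abs_re_le_norm z) (abs_nonneg τ)
        rw [← abs_mul] at this
        have h2 := neg_abs_le (τ * z.re)
        linarith
      have h2 : τ * ‖z‖ ≤ |τ| * ‖z‖ :=
        mul_le_mul_of_nonneg_right (le_abs_self τ) (norm_nonneg z)
      calc _ ≤ Real.exp (-τ * z.re) * Real.exp (τ * ‖z‖) :=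
            mul_le_mul_of_nonneg_left (hR z hz'.le hzR) (Real.exp_pos _).le
        _ = Real.exp (-τ * z.re + τ * ‖z‖) := (Real.exp_add _ _).symm
        _ ≤ _ := Real.exp_le_exp.2 (by linarith)
    · refine ⟨1, ?_⟩
      rw [Filter.eventually_map]
      filter_upwards [Filter.eventually_ge_atTop R, Filter.eventually_ge_atTop 0] with x hx hx0
      have hn : ‖(x : ℂ)‖ = x := by rw [Complex.norm_real, Real.norm_of_nonneg hx0]
      have := hR x (by simpa using hx0) (by rwa [hn])
      rw [hn] at this
      rw [hnorm, Complex.ofReal_re]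
      calc _ ≤ Real.exp (-τ * x) * Real.exp (τ * x) :=
            mul_le_mul_of_nonneg_left this (Real.exp_pos _).le
        _ = 1 := by rw [← Real.exp_add]; simp
    · intro y
      rw [hnorm]
      simpa using him y
  rw [hnorm, neg_mul, Real.exp_neg, inv_mul_le_iff₀ (Real.exp_pos _)] at key
  linarith

/-- The `ℂ`-valued component of `q ↦ q * a` along the slice `L_I`. -/
noncomputable def sliceComponent (I a : ℍ[ℝ]) : ℍ[ℝ] →ₗ[ℝ] ℂ where
  toFun q := ⟨(q * a).re, -(I * (q * a)).re⟩
  map_add' p q := by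
    apply Complex.ext
    · simp [add_mul]
    · simp [mul_add, add_mul]
      ring
  map_smul' c q := by
    apply Complex.ext
    · simp
    · simp
      ring

lemma qSphere_mul_self {I : ℍ[ℝ]} (hI : I ∈ qSphere) : I * I = -1 := by
  obtain ⟨hre, hn⟩ := hI
  have h := Quaternion.normSq_eq_norm_mul_self I
  rw [hn, Quaternion.normSq_def', hre] at h
  ext <;> simp [hre] <;> nlinarith

lemma sliceComponent_mul_left {I : ℍ[ℝ]} (hI : I ∈ qSphere) (a q : ℍ[ℝ]) :
    sliceComponent I a (I * q) = Complex.I * sliceComponent I a q := by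
  have h : I * (I * q * a) = -(q * a) := by
    rw [mul_assoc I q a, ← mul_assoc I I, qSphere_mul_self hI, neg_one_mul]
  apply Complex.ext
  · change (I * q * a).re = (Complex.I * (⟨_, _⟩ : ℂ)).re
    simp [mul_assoc]
  · change -(I * (I * q * a)).re = (Complex.I * (⟨_, _⟩ : ℂ)).im
    rw [h]
    simp

lemma norm_sliceComponent_le {I : ℍ[ℝ]} (hI : I ∈ qSphere) {a : ℍ[ℝ]} (ha : ‖a‖ ≤ 1)
    (q : ℍ[ℝ]) : ‖sliceComponent I a q‖ ≤ ‖q‖ := by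
  obtain ⟨hre, hn⟩ := hI
  have hI2 := Quaternion.normSq_eq_norm_mul_self I
  rw [hn, Quaternion.normSq_def', hre] at hI2
  have hp : ‖q * a‖ ≤ ‖q‖ := by
    rw [norm_mul]
    exact mul_le_of_le_one_right (norm_nonneg q) ha
  refine le_trans ?_ hp
  change ‖(⟨_, _⟩ : ℂ)‖ ≤ _
  generalize q * a = p
  have hp2 := Quaternion.normSq_eq_norm_mul_self p
  rw [Quaternion.normSq_def'] at hp2
  refine (sq_le_sq₀ (norm_nonneg _) (norm_nonneg p)).1 ?_
  rw [Complex.sq_norm, Complex.normSq_mk, sq ‖p‖, ← hp2]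
  have hIre : (I * p).re = -(I.imI * p.imI + I.imJ * p.imJ + I.imK * p.imK) := by
    simp [hre]; ring
  rw [hIre]
  have hI3 : I.imI ^ 2 + I.imJ ^ 2 + I.imK ^ 2 = 1 := by linarith
  have : p.imI ^ 2 + p.imJ ^ 2 + p.imK ^ 2
      = (I.imI ^ 2 + I.imJ ^ 2 + I.imK ^ 2) * (p.imI ^ 2 + p.imJ ^ 2 + p.imK ^ 2) := by
    rw [hI3, one_mul]
  nlinarith [sq_nonneg (I.imI * p.imJ - I.imJ * p.imI), sq_nonneg (I.imI * p.imK - I.imK * p.imI),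
    sq_nonneg (I.imJ * p.imK - I.imK * p.imJ)]

lemma exists_norm_sliceComponent_eq (I q : ℍ[ℝ]) :
    ∃ a : ℍ[ℝ], ‖a‖ ≤ 1 ∧ ‖q‖ ≤ ‖sliceComponent I a q‖ := by
  by_cases hq : q = 0
  · exact ⟨0, by simp, by simp [hq]⟩
  have hq' : ‖q‖ ≠ 0 := norm_ne_zero_iff.2 hq
  refine ⟨‖q‖⁻¹ • star q, ?_, ?_⟩
  · rw [norm_smul, norm_inv, norm_norm, norm_star, inv_mul_cancel₀ hq']
  · have h : (q * (‖q‖⁻¹ • star q)).re = ‖q‖ := by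
      rw [mul_smul_comm, Quaternion.self_mul_star, Quaternion.normSq_eq_norm_mul_self]
      simp [hq']
    calc ‖q‖ = (sliceComponent I (‖q‖⁻¹ • star q) q).re := h.symm
      _ ≤ _ := (le_abs_self _).trans (Complex.abs_re_le_norm _)

lemma continuous_toSlice (I : ℍ[ℝ]) : Continuous (toSlice I) := by
  have h : Continuous fun z : ℂ => ((z.re : ℝ) : ℍ[ℝ]) :=
    Quaternion.continuous_coe.comp Complex.continuous_re
  exact h.add (Complex.continuous_im.smul continuous_const)

lemma SliceRegularOn.differentiableAt_sliceComponent {f : ℍ[ℝ] → ℍ[ℝ]} {Ω : Set ℍ[ℝ]}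
    (hΩ : IsOpen Ω) (hf : SliceRegularOn f Ω) {I : ℍ[ℝ]} (hI : I ∈ qSphere) (a : ℍ[ℝ]) {z : ℂ}
    (hz : toSlice I z ∈ Ω) :
    DifferentiableAt ℂ (fun w => sliceComponent I a (f (toSlice I w))) z := by
  obtain ⟨D, hD, hCR⟩ := hf I hI z hz
  have hD' := hD.hasFDerivAt ((hΩ.preimage (continuous_toSlice I)).mem_nhds hz)
  have hDI : D Complex.I = I * D 1 := by
    have h := congrArg (I * ·) hCR
    simp only [mul_add, ← mul_assoc, qSphere_mul_self hI, mul_zero, neg_mul, one_mul] at h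
    exact (add_neg_eq_zero.1 h).symm
  have hL : HasFDerivAt (fun w => sliceComponent I a (f (toSlice I w)))
      ((LinearMap.toContinuousLinearMap (sliceComponent I a)).comp D) z :=
    (LinearMap.toContinuousLinearMap (sliceComponent I a)).hasFDerivAt.comp z hD'
  refine differentiableAt_complex_iff_differentiableAt_real.2 ⟨hL.differentiableAt, ?_⟩
  rw [hL.fderiv]
  simp [hDI, sliceComponent_mul_left hI]

lemma norm_expI {I : ℍ[ℝ]} (hI : I ∈ qSphere) (θ : ℝ) : ‖expI I θ‖ = 1 := by
  obtain ⟨hre, hn⟩ := hI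
  have hI2 := Quaternion.normSq_eq_norm_mul_self I
  rw [hn, Quaternion.normSq_def', hre] at hI2
  have h := Quaternion.normSq_eq_norm_mul_self (expI I θ)
  rw [Quaternion.normSq_def'] at h
  simp [expI, hre] at h
  have : ‖expI I θ‖ * ‖expI I θ‖ = 1 := by
    rw [expI, ← h]
    nlinarith [Real.sin_sq_add_cos_sq θ]
  nlinarith [norm_nonneg (expI I θ)]

lemma norm_smul_expI {I : ℍ[ℝ]} (hI : I ∈ qSphere) {r : ℝ} (hr : 0 ≤ r) (θ : ℝ) :
    ‖r • expI I θ‖ = r := by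
  rw [norm_smul, norm_expI hI, mul_one, Real.norm_of_nonneg hr]

lemma expI_eq_expI {I : ℍ[ℝ]} (hI : I ∈ qSphere) {α β : ℝ} (h : expI I α = expI I β) :
    ∃ k : ℤ, α = β + k * (2 * Real.pi) := by
  obtain ⟨hre, hn⟩ := hI
  have hI0 : I ≠ 0 := by
    rintro rfl
    simp at hn
  have hcos : Real.cos α = Real.cos β := by
    simpa [expI, hre] using congrArg QuaternionAlgebra.re h
  have hsin : Real.sin α = Real.sin β := by
    rw [expI, expI, hcos, add_right_inj] at h
    exact smul_left_injective ℝ hI0 h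
  have := Real.Angle.cos_sin_inj hcos hsin
  obtain ⟨k, hk⟩ := Real.Angle.angle_eq_iff_two_pi_dvd_sub.1 this
  exact ⟨k, by linarith⟩

lemma zero_notMem_angleSet {I : ℍ[ℝ]} (hI : I ∈ qSphere) (ζ φ : ℝ) : 0 ∉ angleSet I ζ φ := by
  rintro ⟨r, θ, hr, -, h⟩
  have := norm_smul_expI hI hr.le (ζ + θ)
  rw [← h, norm_zero] at this
  exact hr.ne this

lemma smul_expI_notMem_angleSet {I : ℍ[ℝ]} (hI : I ∈ qSphere) {ζ φ r θ : ℝ}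
    (hφ : φ < 2 * Real.pi) (hr : 0 < r) (hθ : |θ| = φ / 2) :
    r • expI I (ζ + θ) ∉ angleSet I ζ φ := by
  rintro ⟨r', θ', hr', hθ', h⟩
  have h1 := norm_smul_expI hI hr'.le (ζ + θ')
  rw [← h, norm_smul_expI hI hr.le] at h1
  subst h1
  obtain ⟨k, hk⟩ := expI_eq_expI hI (smul_right_injective _ hr.ne' h)
  have hk' : |θ - θ'| < 2 * Real.pi := (abs_sub _ _).trans_lt (by linarith)
  have hkθ : θ - θ' = k * (2 * Real.pi) := by linarith
  rw [hkθ, abs_mul, abs_of_pos Real.two_pi_pos] at hk'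
  have hk0 : k = 0 := by
    rw [← Int.abs_lt_one_iff]
    exact_mod_cast (mul_lt_iff_lt_one_left Real.two_pi_pos).1 hk'
  have : θ = θ' := by
    rw [hk0] at hkθ
    simp at hkθ
    linarith
  rw [this] at hθ
  exact hθ'.ne hθ

/-- The map `w ↦ e^{Iζ} w ^ c`, which opens up angles of `L_I` into half-planes. -/
noncomputable def slicePower (I : ℍ[ℝ]) (ζ c : ℝ) (w : ℂ) : ℍ[ℝ] :=
  toSlice I (Complex.exp (ζ * Complex.I) * w ^ (c : ℂ))

lemma toSlice_mul_exp (I : ℍ[ℝ]) (r θ : ℝ) :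
    toSlice I (r * Complex.exp (θ * Complex.I)) = r • expI I θ := by
  rw [Complex.exp_mul_I, ← Complex.ofReal_cos, ← Complex.ofReal_sin]
  simp [toSlice, expI, smul_smul, Quaternion.coe_mul, Quaternion.smul_coe,
    -Complex.ofReal_cos, -Complex.ofReal_sin]

lemma slicePower_of_ne_zero (I : ℍ[ℝ]) (ζ c : ℝ) {w : ℂ} (hw : w ≠ 0) :
    slicePower I ζ c w = (‖w‖ ^ c) • expI I (ζ + c * w.arg) := by
  rw [slicePower, ← toSlice_mul_exp]
  congr 1
  rw [Complex.cpow_def_of_ne_zero hw, Complex.log,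
    Real.rpow_def_of_pos (norm_pos_iff.2 hw), Complex.ofReal_exp, ← Complex.exp_add,
    ← Complex.exp_add]
  congr 1
  push_cast
  ring

lemma slicePower_zero (I : ℍ[ℝ]) (ζ : ℝ) {c : ℝ} (hc : c ≠ 0) : slicePower I ζ c 0 = 0 := by
  simp [slicePower, Complex.zero_cpow (Complex.ofReal_ne_zero.2 hc), toSlice]

lemma norm_slicePower {I : ℍ[ℝ]} (hI : I ∈ qSphere) (ζ : ℝ) {c : ℝ} (hc : 0 < c) (w : ℂ) :
    ‖slicePower I ζ c w‖ = ‖w‖ ^ c := by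
  by_cases hw : w = 0
  · simp [hw, slicePower_zero I ζ hc.ne', Real.zero_rpow hc.ne']
  · rw [slicePower_of_ne_zero I ζ c hw, norm_smul_expI hI (by positivity)]

lemma continuousOn_slicePower (I : ℍ[ℝ]) (ζ : ℝ) {c : ℝ} (hc : 0 < c) :
    ContinuousOn (slicePower I ζ c) {w | 0 ≤ w.re} := by
  intro w hw
  have h : ContinuousAt (fun x : ℂ => x ^ (c : ℂ)) w :=
    Complex.continuousAt_cpow_const_of_re_pos (Or.inl hw) (by simpa using hc)
  exact ((continuous_toSlice I).continuousAt.comp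
    (continuousAt_const.mul h)).continuousWithinAt

lemma slicePower_mem_angleSet (I : ℍ[ℝ]) (ζ : ℝ) {φ : ℝ} (hφ : 0 < φ) {w : ℂ} (hw : 0 < w.re) :
    slicePower I ζ (φ / Real.pi) w ∈ angleSet I ζ φ := by
  have hw0 : w ≠ 0 := by
    rintro rfl
    simp at hw
  have hwp := norm_pos_iff.2 hw0
  refine ⟨‖w‖ ^ (φ / Real.pi), φ / Real.pi * w.arg, by positivity, ?_,
    slicePower_of_ne_zero I ζ _ hw0⟩
  have harg : |w.arg| < Real.pi / 2 := Complex.abs_arg_lt_pi_div_two_iff.2 (Or.inl hw)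
  have hpi := Real.pi_pos
  have hc : 0 < φ / Real.pi := by positivity
  rw [abs_mul, abs_of_pos hc]
  calc _ < φ / Real.pi * (Real.pi / 2) := mul_lt_mul_of_pos_left harg hc
    _ = φ / 2 := by field_simp

lemma slicePower_mul_I_notMem_angleSet {I : ℍ[ℝ]} (hI : I ∈ qSphere) (ζ : ℝ) {φ : ℝ}
    (hφ : 0 < φ) (hφ' : φ < 2 * Real.pi) (y : ℝ) :
    slicePower I ζ (φ / Real.pi) (y * Complex.I) ∉ angleSet I ζ φ := by
  have hpi := Real.pi_pos
  have hc : 0 < φ / Real.pi := by positivity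
  by_cases hy : y = 0
  · simpa [hy, slicePower_zero I ζ hc.ne'] using zero_notMem_angleSet hI ζ φ
  have hw0 : (y * Complex.I : ℂ) ≠ 0 := by simp [hy]
  rw [slicePower_of_ne_zero I ζ _ hw0]
  refine smul_expI_notMem_angleSet hI hφ' (Real.rpow_pos_of_pos (norm_pos_iff.2 hw0) _) ?_
  have harg : |(y * Complex.I : ℂ).arg| = Real.pi / 2 := by
    rcases lt_or_gt_of_ne hy with h | h
    · rw [Complex.arg_eq_neg_pi_div_two_iff.2 (by simpa using h), abs_neg,
        abs_of_pos (by positivity)]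
    · rw [Complex.arg_eq_pi_div_two_iff.2 (by simpa using h), abs_of_pos (by positivity)]
  rw [abs_mul, harg, abs_of_pos hc]
  field_simp

lemma norm_le_maxMod {f : ℍ[ℝ] → ℍ[ℝ]} {Ω : Set ℍ[ℝ]} (hf : ContinuousOn f (closure Ω))
    {q : ℍ[ℝ]} (hq : q ∈ closure Ω) : ‖f q‖ ≤ maxMod f Ω ‖q‖ := by
  refine le_csSup ?_ ⟨q, ⟨hq, by simp⟩, rfl⟩
  refine (IsCompact.image_of_continuousOn ?_ ?_).bddAbove
  · exact (isCompact_sphere 0 ‖q‖).inter_left isClosed_closure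
  · exact (hf.mono Set.inter_subset_left).norm

lemma exists_norm_le_exp_of_growthType {f : ℍ[ℝ] → ℍ[ℝ]} {Ω : Set ℍ[ℝ]} {ρ σ τ : ℝ}
    (hf : ContinuousOn f (closure Ω)) (htype : growthType f Ω ρ = (σ : EReal)) (hτ : σ < τ) :
    ∃ R : ℝ, ∀ q ∈ closure Ω, R ≤ ‖q‖ → ‖f q‖ ≤ Real.exp (τ * ‖q‖ ^ ρ) := by
  have h : growthType f Ω ρ < (τ : EReal) := by
    rw [htype]
    exact_mod_cast hτ
  have hev := (Filter.eventually_lt_of_limsup_lt h).and (Filter.eventually_gt_atTop 0)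
  obtain ⟨R, hR⟩ := Filter.eventually_atTop.1 hev
  refine ⟨R, fun q hq hRq => ?_⟩
  obtain ⟨h1, h2⟩ := hR _ hRq
  have h1 := EReal.coe_lt_coe_iff.1 h1
  rw [div_lt_iff₀ (Real.rpow_pos_of_pos h2 ρ)] at h1
  calc ‖f q‖ ≤ maxMod f Ω ‖q‖ := norm_le_maxMod hf hq
    _ ≤ Real.exp (Real.log (maxMod f Ω ‖q‖)) := Real.le_exp_log _
    _ ≤ _ := Real.exp_le_exp.2 ((le_max_right _ _).trans h1.le)

lemma growthType_nonneg {f : ℍ[ℝ] → ℍ[ℝ]} {Ω : Set ℍ[ℝ]} {ρ σ : ℝ}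
    (htype : growthType f Ω ρ = (σ : EReal)) : 0 ≤ σ := by
  by_contra! hσ
  have h : growthType f Ω ρ < ((0 : ℝ) : EReal) := by
    rw [htype]
    exact_mod_cast hσ
  obtain ⟨r, h1, h2⟩ :=
    ((Filter.eventually_lt_of_limsup_lt h).and (Filter.eventually_gt_atTop 0)).exists
  have h1 := EReal.coe_lt_coe_iff.1 h1
  exact absurd h1 (not_lt.2 (div_nonneg (le_max_left _ _) (Real.rpow_nonneg h2.le ρ)))

/-- Growth estimate in the critical angle. -/
theorem growth_in_critical_angle
    (Ω : Set ℍ[ℝ]) (hΩ : IsSliceDomain Ω)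
    (ζ φ : ℍ[ℝ] → ℝ)
    (hφ : ∀ I ∈ qSphere, 0 < φ I ∧ φ I < 2 * Real.pi)
    (hangle : ∀ I ∈ qSphere, Ω ∩ Set.range (toSlice I) = angleSet I (ζ I) (φ I))
    (f : ℍ[ℝ] → ℍ[ℝ]) (hf : SliceRegularOn f Ω)
    (hcont : ContinuousOn f (closure Ω))
    (ρ σ : ℝ) (hρ : 0 < ρ)
    (horder : growthOrder f Ω = (ρ : EReal))
    (htype : growthType f Ω ρ = (σ : EReal))
    (hopening : sSup (φ '' qSphere) ≤ Real.pi / ρ)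
    (M : ℝ) (hbd : ∀ q ∈ frontier Ω, ‖f q‖ ≤ M) :
    ∀ I ∈ qSphere, ∀ r : ℝ, 0 < r → ∀ θ : ℝ, |θ| < φ I / 2 →
      ‖f (r • expI I (ζ I + θ))‖ ≤ M * Real.exp (σ * r ^ ρ * Real.cos (ρ * θ)) := by
  intro I hI r hr θ hθ
  obtain ⟨hφ0, hφ2⟩ := hφ I hI
  have hpi := Real.pi_pos
  have hφρ : φ I ≤ Real.pi / ρ := by
    refine le_trans (le_csSup ⟨2 * Real.pi, ?_⟩ (Set.mem_image_of_mem φ hI)) hopening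
    rintro _ ⟨J, hJ, rfl⟩
    exact (hφ J hJ).2.le
  have hσ := growthType_nonneg htype
  set c := φ I / Real.pi with hcdef
  have hc : 0 < c := by positivity
  have hcρ : c * ρ ≤ 1 := by
    rw [le_div_iff₀ hρ] at hφρ
    rw [hcdef, div_mul_eq_mul_div, div_le_one hpi]
    exact hφρ
  have hmem : ∀ w : ℂ, 0 < w.re → slicePower I (ζ I) c w ∈ Ω := fun w hw =>
    ((hangle I hI).ge (slicePower_mem_angleSet I (ζ I) hφ0 hw)).1
  have hcl : closure {w : ℂ | 0 < w.re} = {w : ℂ | 0 ≤ w.re} :=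
    Complex.closure_setOfPred_lt_re 0
  have hmapsTo : Set.MapsTo (slicePower I (ζ I) c) {w : ℂ | 0 ≤ w.re} (closure Ω) := by
    have h : Set.MapsTo (slicePower I (ζ I) c) {w : ℂ | 0 < w.re} Ω := hmem
    rw [← hcl]
    refine h.closure_of_continuousOn ?_
    rw [hcl]
    exact continuousOn_slicePower I (ζ I) hc
  have hfrontier : ∀ y : ℝ, slicePower I (ζ I) c (y * Complex.I) ∈ frontier Ω := by
    refine fun y => ⟨hmapsTo (by simp), fun hint => ?_⟩
    refine slicePower_mul_I_notMem_angleSet hI (ζ I) hφ0 hφ2 y ?_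
    rw [← hangle I hI]
    exact ⟨interior_subset hint, _, rfl⟩
  have hM : 0 ≤ M := (norm_nonneg _).trans (hbd _ (hfrontier 0))
  have hhalf : ∀ s : ℝ, (∀ τ > s, ∃ R : ℝ, ∀ w : ℂ, 0 ≤ w.re → R ≤ ‖w‖ →
      ‖f (slicePower I (ζ I) c w)‖ ≤ Real.exp (τ * ‖w‖)) →
      ∀ w : ℂ, 0 ≤ w.re → ‖f (slicePower I (ζ I) c w)‖ ≤ M * Real.exp (s * w.re) := by
    intro s hs w hw
    obtain ⟨a, ha, hle⟩ := exists_norm_sliceComponent_eq I (f (slicePower I (ζ I) c w))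
    refine hle.trans ?_
    refine norm_le_mul_exp_of_exponential_type
      (h := fun w => sliceComponent I a (f (slicePower I (ζ I) c w))) ⟨?_, ?_⟩ ?_ ?_ hw
    · intro z hz
      have hz' : 0 < z.re := hz
      have hinner : DifferentiableAt ℂ
          (fun w : ℂ => Complex.exp (ζ I * Complex.I) * w ^ (c : ℂ)) z :=
        (differentiableAt_id.cpow_const (Or.inl hz')).const_mul _
      exact ((hf.differentiableAt_sliceComponent hΩ.1 hI a (hmem z hz')).comp z
        hinner).differentiableWithinAt
    · rw [hcl]
      exact (LinearMap.continuous_of_finiteDimensional (sliceComponent I a)).comp_continuousOn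
        (hcont.comp (continuousOn_slicePower I (ζ I) hc) hmapsTo)
    · intro τ hτ
      obtain ⟨R, hR⟩ := hs τ hτ
      exact ⟨R, fun w hw hRw => (norm_sliceComponent_le hI ha _).trans (hR w hw hRw)⟩
    · exact fun y => (norm_sliceComponent_le hI ha _).trans (hbd _ (hfrontier y))
  have hgrowth : ∀ τ > σ, ∃ R : ℝ, ∀ w : ℂ, 0 ≤ w.re → R ≤ ‖w‖ →
      ‖f (slicePower I (ζ I) c w)‖ ≤ Real.exp (τ * ‖w‖ ^ (c * ρ)) := by
    intro τ hτ
    obtain ⟨R, hR⟩ := exists_norm_le_exp_of_growthType hcont htype hτ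
    obtain ⟨R', hR'⟩ := Filter.eventually_atTop.1 ((tendsto_rpow_atTop hc).eventually_ge_atTop R)
    refine ⟨R', fun w hw hRw => ?_⟩
    have h := hR _ (hmapsTo hw) (by rw [norm_slicePower hI _ hc]; exact hR' _ hRw)
    rwa [norm_slicePower hI _ hc, ← Real.rpow_mul (norm_nonneg w)] at h
  set w : ℂ := (r ^ c⁻¹ : ℝ) * (Complex.cos (θ / c : ℝ) + Complex.sin (θ / c : ℝ) * Complex.I)
    with hwdef
  have hrc : 0 < r ^ c⁻¹ := Real.rpow_pos_of_pos hr _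
  have hθc : |θ / c| < Real.pi / 2 := by
    rw [abs_div, abs_of_pos hc, div_lt_iff₀ hc]
    calc |θ| < φ I / 2 := hθ
      _ = Real.pi / 2 * c := by rw [hcdef]; field_simp
  obtain ⟨hθ1, hθ2⟩ := abs_lt.1 hθc
  have harg : w.arg = θ / c :=
    Complex.arg_mul_cos_add_sin_mul_I hrc ⟨by linarith, by linarith⟩
  have hnorm : ‖w‖ = r ^ c⁻¹ := by
    rw [hwdef, norm_mul, Complex.norm_real, Real.norm_of_nonneg hrc.le,
      Complex.norm_cos_add_sin_mul_I, mul_one]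
  have hre : w.re = r ^ c⁻¹ * Real.cos (θ / c) := by
    rw [hwdef, Complex.re_ofReal_mul, ← Complex.ofReal_cos, ← Complex.ofReal_sin]
    simp [-Complex.ofReal_cos, -Complex.ofReal_sin]
  have hcos : 0 < Real.cos (θ / c) := Real.cos_pos_of_mem_Ioo ⟨hθ1, hθ2⟩
  have hw : 0 ≤ w.re := hre ▸ (mul_pos hrc hcos).le
  have hw0 : w ≠ 0 := norm_pos_iff.1 (hnorm ▸ hrc)
  have hpoint : slicePower I (ζ I) c w = r • expI I (ζ I + θ) := by
    rw [slicePower_of_ne_zero I _ c hw0, harg, hnorm, ← Real.rpow_mul hr.le,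
      inv_mul_cancel₀ hc.ne', Real.rpow_one, mul_div_cancel₀ _ hc.ne']
  rw [← hpoint]
  rcases hcρ.eq_or_lt with hcrit | hsub
  · have hinv : c⁻¹ = ρ := (eq_inv_of_mul_eq_one_right hcrit).symm
    have h := hhalf σ (by simpa only [hcrit, Real.rpow_one] using hgrowth) w hw
    rw [hre, div_eq_mul_inv, hinv, mul_comm θ, ← mul_assoc] at h
    exact h
  · have h := hhalf 0 (fun τ hτ => ?_) w hw
    · rw [zero_mul, Real.exp_zero] at h
      refine h.trans (mul_le_mul_of_nonneg_left (Real.one_le_exp ?_) hM)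
      have hcosρ : 0 ≤ Real.cos (ρ * θ) := by
        refine Real.cos_nonneg_of_mem_Icc (abs_le.1 ?_)
        have hle : c * ρ * |θ / c| ≤ |θ / c| :=
          mul_le_of_le_one_left (abs_nonneg _) hcρ
        have heq : |ρ * θ| = c * ρ * |θ / c| := by
          rw [abs_div, abs_mul, abs_of_pos hρ, abs_of_pos hc]
          field_simp
        linarith
      positivity
    · obtain ⟨R, hR⟩ := hgrowth (σ + 1) (by linarith)
      have hlim : Filter.Tendsto (fun x : ℝ => x ^ (1 - c * ρ)) Filter.atTop Filter.atTop :=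
        tendsto_rpow_atTop (by linarith)
      obtain ⟨R', hR'⟩ := Filter.eventually_atTop.1
        ((hlim.eventually_ge_atTop ((σ + 1) / τ)).and (Filter.eventually_gt_atTop 0))
      refine ⟨max R R', fun w hw hRw => ?_⟩
      obtain ⟨h1, h2⟩ := hR' _ ((le_max_right _ _).trans hRw)
      refine (hR w hw ((le_max_left _ _).trans hRw)).trans (Real.exp_le_exp.2 ?_)
      rw [div_le_iff₀ hτ] at h1
      calc (σ + 1) * ‖w‖ ^ (c * ρ) ≤ ‖w‖ ^ (1 - c * ρ) * τ * ‖w‖ ^ (c * ρ) :=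
            mul_le_mul_of_nonneg_right h1 (by positivity)
        _ = τ * (‖w‖ ^ (1 - c * ρ) * ‖w‖ ^ (c * ρ)) := by ring
        _ = τ * ‖w‖ := by rw [← Real.rpow_add h2, sub_add_cancel, Real.rpow_one]
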